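/- For every positive integer n and all nonnegative integers k and l, the following polynomial identity in x_1,…,x_n holds: h_k(x_1,…,x_n) multiplied by the complete homogeneous symmetric polynomial of degree l in the variables {x_i x_j : 1 ≤ i < j ≤ n} equals the sum of the Schur polynomials s_λ(x_1,…,x_n) over all partitions λ of k+2l having exactly k odd columns (i.e. the conjugate partition λ' has exactly k odd parts). Here h_k is the complete homogeneous symmetric polynomial of degree k. -/

import Mathlib

/-- The weight of a semistandard Young tableau: `ssytWeight T i` is the number of cells of the
tableau whose entry equals `i`. -/
def ssytWeight {μ : YoungDiagram} (T : SemistandardYoungTableau μ) (i : ℕ) : ℕ :=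
  (μ.cells.filter fun c => T c.1 c.2 = i).card

/-- `tabCard μ ν` is the number of semistandard Young tableaux of shape `μ` and weight `ν`,
where `ν : Fin n → ℕ`: the entry `j` (for `j < n`) occurs exactly `ν j` times, and no entry
`≥ n` occurs. -/
noncomputable def tabCard (μ : YoungDiagram) {n : ℕ} (ν : Fin n → ℕ) : ℕ :=
  Set.ncard {T : SemistandardYoungTableau μ |
    ∀ j : ℕ, ssytWeight T j = if h : j < n then ν ⟨j, h⟩ else 0}

/-- The Schur polynomial `s_μ(x_0, …, x_{n-1})`, as the generating function of semistandard
Young tableaux of shape `μ` with entries in `{0, …, n-1}`. -/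
noncomputable def schurPoly (n : ℕ) (μ : YoungDiagram) : MvPolynomial (Fin n) ℤ :=
  ∑ᶠ (T : SemistandardYoungTableau μ) (_ : ∀ c ∈ μ.cells, T c.1 c.2 < n),
    ∏ i : Fin n, (MvPolynomial.X i : MvPolynomial (Fin n) ℤ) ^ ssytWeight T (i : ℕ)

/-- The number of odd rows (odd parts) of a Young diagram. -/
def oddRowsCount (lam : YoungDiagram) : ℕ :=
  lam.rowLens.countP fun r => r % 2 = 1

/-- The number of odd columns of a Young diagram. -/
def oddColsCount (lam : YoungDiagram) : ℕ :=
  oddRowsCount lam.transpose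

/-- A Young diagram is a *threshold* partition if its Frobenius coordinates satisfy
`β i = α i + 1` for each `i` up to the Durfee rank; with 0-indexed diagrams this says that
`colLen i = rowLen i + 1` for each diagonal cell `(i, i)`. -/
def YoungDiagram.IsThreshold (lam : YoungDiagram) : Prop :=
  ∀ i : ℕ, (i, i) ∈ lam → lam.colLen i = lam.rowLen i + 1

namespace YoungDiagram

/-- `ν.Interlaces lam` says that `ν ⊆ lam` and `lam / ν` is a horizontal strip. -/
def Interlaces (ν lam : YoungDiagram) : Prop :=
  ∀ i, ν.rowLen i ≤ lam.rowLen i ∧ lam.rowLen (i + 1) ≤ ν.rowLen i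

theorem ext_rowLen {μ ν : YoungDiagram} (h : ∀ i, μ.rowLen i = ν.rowLen i) : μ = ν := by
  ext ⟨i, j⟩
  rw [mem_cells, mem_cells, mem_iff_lt_rowLen, mem_iff_lt_rowLen, h]

theorem Interlaces.le {ν lam : YoungDiagram} (h : ν.Interlaces lam) : ν ≤ lam := by
  rintro ⟨i, j⟩ hc
  have hc' : (i, j) ∈ ν := hc
  change (i, j) ∈ lam
  rw [mem_iff_lt_rowLen] at *
  exact hc'.trans_le (h i).1

theorem card_mono {ν lam : YoungDiagram} (h : ν ≤ lam) : ν.card ≤ lam.card :=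
  Finset.card_le_card (cells_subset_iff.2 h)

theorem exists_rowLen_eq_zero (μ : YoungDiagram) : ∃ N, μ.rowLen N = 0 := by
  refine ⟨μ.colLen 0, ?_⟩
  by_contra h
  have := mem_iff_lt_rowLen.2 (Nat.pos_of_ne_zero h)
  rw [mem_iff_lt_colLen] at this
  omega

open Classical in
/-- The Young diagram with row lengths `f`, when `f` is antitone and eventually zero
(and the empty diagram otherwise). -/
noncomputable def ofRowLenFun (f : ℕ → ℕ) : YoungDiagram :=
  if h : Antitone f ∧ ∃ N, f N = 0 then
    { cells := (Finset.range (Nat.find h.2) ×ˢ Finset.range (f 0)).filter fun c => c.2 < f c.1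
      isLowerSet := by
        rintro ⟨i, j⟩ ⟨i', j'⟩ ⟨hi, hj⟩ hc
        simp only [Finset.coe_filter, Finset.mem_product, Finset.mem_range, Set.mem_ofPred_eq]
          at hc ⊢ hi hj
        have h1 := h.1 hi
        exact ⟨⟨by omega, by omega⟩, by omega⟩ }
  else ⊥

theorem rowLen_ofRowLenFun {f : ℕ → ℕ} (hf : Antitone f) (h0 : ∃ N, f N = 0) (i : ℕ) :
    (ofRowLenFun f).rowLen i = f i := by
  classical
  refine eq_of_forall_lt_iff fun j => ?_
  rw [← mem_iff_lt_rowLen, ofRowLenFun, dif_pos ⟨hf, h0⟩]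
  rw [← mem_cells]
  simp only [Finset.mem_filter, Finset.mem_product, Finset.mem_range]
  refine ⟨fun h => h.2, fun h => ⟨⟨?_, h.trans_le (hf (Nat.zero_le i))⟩, h⟩⟩
  by_contra hi
  have h1 := hf (not_lt.1 hi)
  rw [Nat.find_spec h0] at h1
  omega

/-- Given `lam` interlacing above both `μ` and `ν`, a diagram interlacing below both. -/
noncomputable def lowerMate (μ ν lam : YoungDiagram) : YoungDiagram :=
  ofRowLenFun fun m => min (μ.rowLen m) (ν.rowLen m) +
    max (μ.rowLen (m + 1)) (ν.rowLen (m + 1)) - lam.rowLen (m + 1)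

/-- The row lengths of `upperMate`. -/
def upperMateRow (μ ν ρ : YoungDiagram) (p : ℕ) : ℕ → ℕ
  | 0 => max (μ.rowLen 0) (ν.rowLen 0) + p
  | m + 1 => min (μ.rowLen m) (ν.rowLen m) + max (μ.rowLen (m + 1)) (ν.rowLen (m + 1)) -
      ρ.rowLen m

/-- Given `ρ` interlacing below both `μ` and `ν`, the diagram interlacing above both whose
lower mate is `ρ` and whose first row exceeds those of `μ` and `ν` by `p`. -/
noncomputable def upperMate (μ ν ρ : YoungDiagram) (p : ℕ) : YoungDiagram :=
  ofRowLenFun (upperMateRow μ ν ρ p)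

/-- The excess of the first row of `lam` over those of `μ` and `ν`. -/
def topExcess (μ ν lam : YoungDiagram) : ℕ :=
  lam.rowLen 0 - max (μ.rowLen 0) (ν.rowLen 0)

/-- The relation between a diagram `lam` above `μ` and `ν` and a diagram `ρ` below them that
underlies the exchange of horizontal strips. -/
structure IsMate (μ ν lam ρ : YoungDiagram) (p : ℕ) : Prop where
  left_up : μ.Interlaces lam
  right_up : ν.Interlaces lam
  left_down : ρ.Interlaces μ
  right_down : ρ.Interlaces ν
  zero : lam.rowLen 0 = max (μ.rowLen 0) (ν.rowLen 0) + p
  succ : ∀ m, ρ.rowLen m + lam.rowLen (m + 1) =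
    min (μ.rowLen m) (ν.rowLen m) + max (μ.rowLen (m + 1)) (ν.rowLen (m + 1))

variable {μ ν lam ρ : YoungDiagram} {p : ℕ}

theorem isMate_lowerMate (h1 : μ.Interlaces lam) (h2 : ν.Interlaces lam) :
    IsMate μ ν lam (lowerMate μ ν lam) (topExcess μ ν lam) := by
  have key : ∀ m, (lowerMate μ ν lam).rowLen m = min (μ.rowLen m) (ν.rowLen m) +
      max (μ.rowLen (m + 1)) (ν.rowLen (m + 1)) - lam.rowLen (m + 1) := by
    refine rowLen_ofRowLenFun (antitone_nat_of_succ_le fun m => ?_) ?_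
    · have := h1 m; have := h2 m; have := h1 (m + 1); have := h2 (m + 1)
      have := h1 (m + 1 + 1); have := h2 (m + 1 + 1)
      omega
    · obtain ⟨N, hN⟩ := μ.exists_rowLen_eq_zero
      refine ⟨N, ?_⟩
      have := h1 N; have := h2 N; have := h1 (N + 1); have := h2 (N + 1)
      omega
  refine ⟨h1, h2, fun m => ?_, fun m => ?_, ?_, fun m => ?_⟩
  · rw [key]; have := h1 m; have := h2 m; have := h1 (m + 1); have := h2 (m + 1)
    omega
  · rw [key]; have := h1 m; have := h2 m; have := h1 (m + 1); have := h2 (m + 1)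
    omega
  · have := h1 0; have := h2 0
    rw [topExcess]; omega
  · rw [key]; have := h1 m; have := h2 m; have := h1 (m + 1); have := h2 (m + 1)
    omega

theorem isMate_upperMate (h1 : ρ.Interlaces μ) (h2 : ρ.Interlaces ν) (p : ℕ) :
    IsMate μ ν (upperMate μ ν ρ p) ρ p := by
  have key : ∀ m, (upperMate μ ν ρ p).rowLen m = upperMateRow μ ν ρ p m := by
    refine rowLen_ofRowLenFun (antitone_nat_of_succ_le fun m => ?_) ?_
    · cases m with
      | zero =>
        have := h1 0; have := h2 0
        simp only [upperMateRow]; omega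
      | succ m =>
        have := h1 m; have := h2 m; have := h1 (m + 1); have := h2 (m + 1)
        simp only [upperMateRow]; omega
    · obtain ⟨N, hN⟩ := μ.exists_rowLen_eq_zero
      obtain ⟨M, hM⟩ := ν.exists_rowLen_eq_zero
      refine ⟨N + M + 1, ?_⟩
      have := h1 (N + M); have := h2 (N + M)
      have := μ.rowLen_anti N (N + M) (by omega)
      have := ν.rowLen_anti M (N + M) (by omega)
      simp only [upperMateRow]; omega
  have k0 := key 0
  have ks := fun m => key (m + 1)
  simp only [upperMateRow] at k0 ks
  refine ⟨fun m => ?_, fun m => ?_, h1, h2, k0, fun m => ?_⟩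
  · rw [ks]
    have := h1 m; have := h2 m
    refine ⟨?_, by omega⟩
    cases m with
    | zero => omega
    | succ m => rw [ks]; have := h1 m; have := h2 m; omega
  · rw [ks]
    have := h1 m; have := h2 m
    refine ⟨?_, by omega⟩
    cases m with
    | zero => omega
    | succ m => rw [ks]; have := h1 m; have := h2 m; omega
  · rw [ks]
    have := h1 m; have := h2 m; omega

theorem IsMate.lowerMate_eq (h : IsMate μ ν lam ρ p) : lowerMate μ ν lam = ρ := by
  refine ext_rowLen fun m => ?_
  have h1 := (isMate_lowerMate h.left_up h.right_up).succ m
  have h2 := h.succ m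
  omega

theorem IsMate.topExcess_eq (h : IsMate μ ν lam ρ p) : topExcess μ ν lam = p := by
  have := h.zero
  rw [topExcess]; omega

theorem IsMate.upperMate_eq (h : IsMate μ ν lam ρ p) : upperMate μ ν ρ p = lam := by
  have h1 := isMate_upperMate h.left_down h.right_down p
  refine ext_rowLen fun m => ?_
  cases m with
  | zero => rw [h1.zero, h.zero]
  | succ m =>
    have := h1.succ m
    have := h.succ m
    omega

theorem sum_cells_eq_sum_rowLen (μ : YoungDiagram) {N : ℕ} (hN : μ.rowLen N = 0) (g : ℕ → ℤ) :
    ∑ c ∈ μ.cells, g c.1 = ∑ i ∈ Finset.range N, (μ.rowLen i : ℤ) * g i := by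
  rw [← Finset.sum_fiberwise_of_maps_to (g := Prod.fst) (t := Finset.range N)]
  · refine Finset.sum_congr rfl fun i _ => ?_
    rw [rowLen_eq_card, row, ← nsmul_eq_mul, ← Finset.sum_const]
    exact Finset.sum_congr rfl fun c hc => by rw [(Finset.mem_filter.1 hc).2]
  · rintro ⟨i, j⟩ hc
    rw [mem_cells, mem_iff_lt_rowLen] at hc
    rw [Finset.mem_range]
    by_contra h
    have := μ.rowLen_anti N i (by simpa using h)
    omega

theorem card_eq_sum_rowLen (μ : YoungDiagram) {N : ℕ} (hN : μ.rowLen N = 0) :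
    (μ.card : ℤ) = ∑ i ∈ Finset.range N, (μ.rowLen i : ℤ) := by
  have := μ.sum_cells_eq_sum_rowLen hN fun _ => 1
  simpa using this

theorem oddColsCount_eq_sum_cells (μ : YoungDiagram) :
    (oddColsCount μ : ℤ) = ∑ c ∈ μ.cells, (-1 : ℤ) ^ c.1 := by
  have h : oddColsCount μ =
      ((Finset.range (μ.rowLen 0)).filter fun j => μ.colLen j % 2 = 1).card := by
    rw [oddColsCount, oddRowsCount, rowLens, List.countP_map]
    simp only [colLen_transpose, Function.comp_def, rowLen_transpose]
    rw [List.countP_eq_length_filter]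
    rfl
  rw [h, Finset.card_filter, ← Finset.sum_fiberwise_of_maps_to (g := Prod.snd)
    (t := Finset.range (μ.rowLen 0))]
  · push_cast
    refine Finset.sum_congr rfl fun j _ => ?_
    change _ = ∑ c ∈ μ.col j, (-1 : ℤ) ^ c.1
    rw [col_eq_prod, Finset.sum_product]
    simp only [Finset.sum_singleton]
    rw [neg_one_geom_sum]
    split_ifs with h1 h2 h2 <;> first | rfl | (rw [Nat.even_iff] at h2; omega)
  · rintro ⟨i, j⟩ hc
    rw [mem_cells] at hc
    rw [Finset.mem_range, ← mem_iff_lt_rowLen]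
    exact μ.up_left_mem (Nat.zero_le _) le_rfl hc

theorem oddColsCount_le_card (μ : YoungDiagram) : oddColsCount μ ≤ μ.card := by
  have : (oddColsCount μ : ℤ) ≤ μ.card := by
    rw [oddColsCount_eq_sum_cells, YoungDiagram.card, Finset.card_eq_sum_ones]
    push_cast
    refine Finset.sum_le_sum fun c _ => ?_
    rcases neg_one_pow_eq_or ℤ c.1 with h | h <;> rw [h]; norm_num
  exact_mod_cast this

theorem IsMate.rowLen_eq_zero (h : IsMate μ ν lam ρ p) :
    ∃ N, lam.rowLen (N + 1) = 0 ∧ μ.rowLen (N + 1) = 0 ∧ ν.rowLen (N + 1) = 0 ∧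
      μ.rowLen N = 0 ∧ ν.rowLen N = 0 ∧ ρ.rowLen N = 0 := by
  obtain ⟨N, hN⟩ := lam.exists_rowLen_eq_zero
  have := lam.rowLen_anti N (N + 1) (by omega)
  have := h.left_up N; have := h.right_up N; have := h.left_down N
  have := h.left_up (N + 1); have := h.right_up (N + 1)
  exact ⟨N, by omega⟩

theorem IsMate.card_add_card (h : IsMate μ ν lam ρ p) :
    lam.card + ρ.card = μ.card + ν.card + p := by
  obtain ⟨N, h1, h2, h3, h4, h5, h6⟩ := h.rowLen_eq_zero
  have key : (lam.card : ℤ) + ρ.card = μ.card + ν.card + p := by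
    rw [card_eq_sum_rowLen lam h1, card_eq_sum_rowLen ρ h6]
    have hmm : (μ.card : ℤ) + ν.card =
        ∑ i ∈ Finset.range N, (min (μ.rowLen i) (ν.rowLen i) : ℤ) +
        ∑ i ∈ Finset.range (N + 1), (max (μ.rowLen i) (ν.rowLen i) : ℤ) := by
      rw [Finset.sum_range_succ, h4, h5, card_eq_sum_rowLen μ h4, card_eq_sum_rowLen ν h5,
        ← Finset.sum_add_distrib]
      simp only [Nat.cast_zero, max_self, add_zero]
      rw [← Finset.sum_add_distrib]
      exact Finset.sum_congr rfl fun i _ => (min_add_max _ _).symm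
    have hz : (lam.rowLen 0 : ℤ) = max (μ.rowLen 0 : ℤ) (ν.rowLen 0) + p := by
      exact_mod_cast h.zero
    have hs : ∑ i ∈ Finset.range N, (ρ.rowLen i : ℤ) +
        ∑ i ∈ Finset.range N, (lam.rowLen (i + 1) : ℤ) =
        ∑ i ∈ Finset.range N, (min (μ.rowLen i) (ν.rowLen i) : ℤ) +
        ∑ i ∈ Finset.range N, (max (μ.rowLen (i + 1)) (ν.rowLen (i + 1)) : ℤ) := by
      rw [← Finset.sum_add_distrib, ← Finset.sum_add_distrib]
      exact Finset.sum_congr rfl fun i _ => by exact_mod_cast h.succ i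
    rw [hmm, Finset.sum_range_succ', Finset.sum_range_succ', hz]
    linarith
  exact_mod_cast key

theorem IsMate.oddColsCount_eq (h : IsMate ν ν lam ρ p) :
    oddColsCount lam = oddColsCount ρ + p := by
  obtain ⟨N, h1, h2, -, h4, -, h6⟩ := h.rowLen_eq_zero
  have key : (oddColsCount lam : ℤ) = oddColsCount ρ + p := by
    rw [oddColsCount_eq_sum_cells, oddColsCount_eq_sum_cells,
      sum_cells_eq_sum_rowLen lam h1 fun i => (-1) ^ i,
      sum_cells_eq_sum_rowLen ρ h6 fun i => (-1) ^ i, Finset.sum_range_succ']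
    have hz : (lam.rowLen 0 : ℤ) = ν.rowLen 0 + p := by
      have := h.zero
      rw [max_self] at this
      exact_mod_cast this
    have hs : ∑ i ∈ Finset.range N, (ρ.rowLen i : ℤ) * (-1) ^ i -
        ∑ i ∈ Finset.range N, (lam.rowLen (i + 1) : ℤ) * (-1) ^ (i + 1) = ν.rowLen 0 := by
      have ht : ∑ i ∈ Finset.range N, ((ν.rowLen (i + 1) : ℤ) * (-1) ^ (i + 1) -
          ν.rowLen i * (-1) ^ i) = - ν.rowLen 0 := by
        rw [Finset.sum_range_sub (fun i => (ν.rowLen i : ℤ) * (-1) ^ i), h4]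
        simp
      rw [← neg_inj, ← ht, ← Finset.sum_sub_distrib, ← Finset.sum_neg_distrib]
      refine Finset.sum_congr rfl fun i _ => ?_
      have := h.succ i
      rw [max_self, min_self] at this
      have : (ρ.rowLen i : ℤ) + lam.rowLen (i + 1) = ν.rowLen i + ν.rowLen (i + 1) := by
        exact_mod_cast this
      rw [pow_succ]
      linear_combination (-(-1) ^ i : ℤ) * this
    rw [hz]
    simp only [pow_zero, mul_one]
    linarith
  exact_mod_cast key

theorem finite_card_eq (m : ℕ) : {lam : YoungDiagram | lam.card = m}.Finite := by
  have hinj : Function.Injective (cells : YoungDiagram → Finset (ℕ × ℕ)) :=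
    fun _ _ => YoungDiagram.ext
  refine Set.Finite.of_finite_image (f := cells) ?_ hinj.injOn
  refine ((Finset.range m ×ˢ Finset.range m).powerset).finite_toSet.subset ?_
  rintro _ ⟨lam, rfl, rfl⟩
  rw [Finset.mem_coe, Finset.mem_powerset]
  rintro ⟨i, j⟩ hc
  have h1 : lam.rowLen i ≤ lam.card := by
    rw [rowLen_eq_card]
    exact Finset.card_filter_le _ _
  have h2 : lam.colLen j ≤ lam.card := by
    rw [colLen_eq_card]
    exact Finset.card_filter_le _ _
  have h3 := mem_iff_lt_rowLen.1 ((mem_cells _).1 hc)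
  have h4 := mem_iff_lt_colLen.1 ((mem_cells _).1 hc)
  rw [Finset.mem_product, Finset.mem_range, Finset.mem_range]
  exact ⟨by dsimp only; omega, by dsimp only; omega⟩

theorem finite_interlaces (lam : YoungDiagram) : {ν : YoungDiagram | ν.Interlaces lam}.Finite := by
  have h : (⋃ m ∈ Finset.range (lam.card + 1), {ν : YoungDiagram | ν.card = m}).Finite :=
    (Finset.range (lam.card + 1)).finite_toSet.biUnion fun m _ => finite_card_eq m
  refine h.subset fun ν hν => ?_
  have := card_mono (Interlaces.le hν)
  simp only [Set.mem_iUnion, Finset.mem_range]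
  exact ⟨ν.card, by omega, rfl⟩

/-- The diagrams obtained from `lam` by removing a horizontal strip. -/
noncomputable def below (lam : YoungDiagram) : Finset YoungDiagram :=
  (finite_interlaces lam).toFinset

/-- The diagrams obtained from `μ` by adding a horizontal strip of size `r`. -/
noncomputable def above (μ : YoungDiagram) (r : ℕ) : Finset YoungDiagram :=
  ((finite_card_eq (μ.card + r)).subset
    (fun _ h => h.2 : {lam | μ.Interlaces lam ∧ lam.card = μ.card + r} ⊆ _)).toFinset

/-- The diagrams with `k + 2 * l` cells and exactly `k` odd columns. -/
noncomputable def withOddCols (k l : ℕ) : Finset YoungDiagram :=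
  ((finite_card_eq (k + 2 * l)).subset
    (fun _ h => h.1 : {lam | lam.card = k + 2 * l ∧ oddColsCount lam = k} ⊆ _)).toFinset

@[simp] theorem mem_below : ν ∈ below lam ↔ ν.Interlaces lam := by simp [below]

@[simp] theorem mem_above {r : ℕ} :
    lam ∈ above μ r ↔ μ.Interlaces lam ∧ lam.card = μ.card + r := by simp [above]

@[simp] theorem mem_withOddCols {k l : ℕ} :
    lam ∈ withOddCols k l ↔ lam.card = k + 2 * l ∧ oddColsCount lam = k := by simp [withOddCols]

/-- Exchange of adding and removing horizontal strips. -/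
theorem sum_above_below {M : Type*} [AddCommMonoid M] (μ : YoungDiagram) (r : ℕ)
    (f : YoungDiagram → ℕ → M) :
    ∑ lam ∈ above μ r, ∑ ν ∈ below lam, f ν (lam.card - ν.card) =
      ∑ ρ ∈ below μ, ∑ jk ∈ Finset.HasAntidiagonal.antidiagonal r, ∑ ν ∈ above ρ jk.1,
        f ν (μ.card - ρ.card + jk.2) := by
  simp only [Finset.sum_sigma']
  refine Finset.sum_nbij'
    (fun a => ⟨lowerMate μ a.2 a.1, (a.2.card - (lowerMate μ a.2 a.1).card,
      topExcess μ a.2 a.1), a.2⟩)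
    (fun b => ⟨upperMate μ b.2.2 b.1 b.2.1.2, b.2.2⟩) ?_ ?_ ?_ ?_ ?_
  · rintro ⟨lam, ν⟩ h
    simp only [Finset.mem_sigma, mem_above, mem_below, Finset.HasAntidiagonal.mem_antidiagonal] at h ⊢
    have hm := isMate_lowerMate h.1.1 h.2
    have h1 := hm.card_add_card
    have h2 := card_mono hm.right_down.le
    exact ⟨hm.left_down, by omega, hm.right_down, by omega⟩
  · rintro ⟨ρ, ⟨j, k⟩, ν⟩ h
    simp only [Finset.mem_sigma, mem_above, mem_below, Finset.HasAntidiagonal.mem_antidiagonal] at h ⊢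
    have hm := isMate_upperMate h.1 h.2.2.1 k
    have h1 := hm.card_add_card
    exact ⟨⟨hm.left_up, by omega⟩, hm.right_up⟩
  · rintro ⟨lam, ν⟩ h
    simp only [Finset.mem_sigma, mem_above, mem_below] at h ⊢
    rw [(isMate_lowerMate h.1.1 h.2).upperMate_eq]
  · rintro ⟨ρ, ⟨j, k⟩, ν⟩ h
    simp only [Finset.mem_sigma, mem_above, mem_below, Finset.HasAntidiagonal.mem_antidiagonal] at h ⊢
    have hm := isMate_upperMate h.1 h.2.2.1 k
    rw [hm.lowerMate_eq, hm.topExcess_eq, h.2.2.2, Nat.add_sub_cancel_left]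
  · rintro ⟨lam, ν⟩ h
    simp only [Finset.mem_sigma, mem_above, mem_below] at h ⊢
    have hm := isMate_lowerMate h.1.1 h.2
    have h1 := hm.card_add_card
    have h2 := card_mono hm.left_down.le
    congr 1
    omega

/-- The effect of removing a horizontal strip on the diagrams with a given number of odd
columns. -/
theorem sum_withOddCols_below {M : Type*} [AddCommMonoid M] (k l : ℕ)
    (f : YoungDiagram → ℕ → M) :
    ∑ lam ∈ withOddCols k l, ∑ ν ∈ below lam, f ν (lam.card - ν.card) =
      ∑ cp ∈ Finset.HasAntidiagonal.antidiagonal k, ∑ ab ∈ Finset.HasAntidiagonal.antidiagonal l,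
        ∑ μ ∈ withOddCols cp.1 ab.1, ∑ ν ∈ above μ ab.2, f ν (ab.2 + cp.2) := by
  simp only [Finset.sum_sigma']
  refine Finset.sum_nbij'
    (fun a => ⟨(oddColsCount (lowerMate a.2 a.2 a.1), topExcess a.2 a.2 a.1),
      (l - (a.2.card - (lowerMate a.2 a.2 a.1).card), a.2.card - (lowerMate a.2 a.2 a.1).card),
      lowerMate a.2 a.2 a.1, a.2⟩)
    (fun b => ⟨upperMate b.2.2.2 b.2.2.2 b.2.2.1 b.1.2, b.2.2.2⟩) ?_ ?_ ?_ ?_ ?_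
  · rintro ⟨lam, ν⟩ h
    simp only [Finset.mem_sigma, mem_above, mem_below, mem_withOddCols,
      Finset.HasAntidiagonal.mem_antidiagonal] at h ⊢
    have hm := isMate_lowerMate h.2 h.2
    have h1 := hm.card_add_card
    have h2 := card_mono hm.right_down.le
    have h3 := hm.oddColsCount_eq
    have h4 := oddColsCount_le_card (lowerMate ν ν lam)
    exact ⟨by omega, by omega, ⟨by omega, trivial⟩, hm.right_down, by omega⟩
  · rintro ⟨⟨c, p⟩, ⟨a, b⟩, ρ, ν⟩ h
    simp only [Finset.mem_sigma, mem_above, mem_below, mem_withOddCols,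
      Finset.HasAntidiagonal.mem_antidiagonal] at h ⊢
    have hm := isMate_upperMate h.2.2.2.1 h.2.2.2.1 p
    have h1 := hm.card_add_card
    have h3 := hm.oddColsCount_eq
    exact ⟨⟨by omega, by omega⟩, hm.right_up⟩
  · rintro ⟨lam, ν⟩ h
    simp only [Finset.mem_sigma, mem_withOddCols, mem_below] at h ⊢
    rw [(isMate_lowerMate h.2 h.2).upperMate_eq]
  · rintro ⟨⟨c, p⟩, ⟨a, b⟩, ρ, ν⟩ h
    simp only [Finset.mem_sigma, mem_above, mem_withOddCols,
      Finset.HasAntidiagonal.mem_antidiagonal] at h ⊢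
    have hm := isMate_upperMate h.2.2.2.1 h.2.2.2.1 p
    have h5 : l - b = a := by omega
    rw [hm.lowerMate_eq, hm.topExcess_eq, h.2.2.2.2, Nat.add_sub_cancel_left, h.2.2.1.2, h5]
  · rintro ⟨lam, ν⟩ h
    simp only [Finset.mem_sigma, mem_withOddCols, mem_below] at h ⊢
    have hm := isMate_lowerMate h.2 h.2
    have h1 := hm.card_add_card
    have h2 := card_mono hm.left_down.le
    congr 1
    omega

end YoungDiagram

namespace SemistandardYoungTableau

open YoungDiagram

variable {lam ν : YoungDiagram}

theorem finite_entry_lt (n : ℕ) (lam : YoungDiagram) :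
    {T : SemistandardYoungTableau lam | ∀ c ∈ lam.cells, T c.1 c.2 < n}.Finite := by
  have h : (Set.univ.pi fun _ : lam.cells => Set.Iio n).Finite :=
    Set.Finite.pi fun _ => Set.finite_Iio n
  refine Set.Finite.of_injOn (f := fun T (c : lam.cells) => T c.1.1 c.1.2) ?_ ?_ h
  · intro T hT c _
    exact hT c.1 c.2
  · intro T _ T' _ hTT
    ext i j
    by_cases hc : (i, j) ∈ lam
    · exact congrFun hTT ⟨(i, j), (mem_cells _).2 hc⟩
    · rw [T.zeros hc, T'.zeros hc]

/-- The tableaux of shape `lam` with entries less than `n`. -/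
noncomputable def entryLt (n : ℕ) (lam : YoungDiagram) : Finset (SemistandardYoungTableau lam) :=
  (finite_entry_lt n lam).toFinset

@[simp] theorem mem_entryLt {n : ℕ} {T : SemistandardYoungTableau lam} :
    T ∈ entryLt n lam ↔ ∀ i j, (i, j) ∈ lam → T i j < n := by
  simp [entryLt]

/-- The cells of a tableau with entries less than `n` form a Young diagram. -/
def subdiagram (T : SemistandardYoungTableau lam) (n : ℕ) : YoungDiagram where
  cells := lam.cells.filter fun c => T c.1 c.2 < n
  isLowerSet := by
    rintro ⟨i, j⟩ ⟨i', j'⟩ ⟨hi, hj⟩ hc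
    simp only [Finset.coe_filter, mem_cells, Set.mem_ofPred_eq] at hc hi hj ⊢
    have h1 := lam.up_left_mem hi le_rfl hc.1
    exact ⟨lam.up_left_mem hi hj hc.1,
      ((T.row_weak_of_le hj h1).trans (T.col_weak hi hc.1)).trans_lt hc.2⟩

theorem mem_subdiagram {T : SemistandardYoungTableau lam} {n i j : ℕ} :
    (i, j) ∈ T.subdiagram n ↔ (i, j) ∈ lam ∧ T i j < n := by
  rw [← mem_cells, subdiagram, Finset.mem_filter, mem_cells]

theorem subdiagram_interlaces {T : SemistandardYoungTableau lam} {n : ℕ}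
    (hT : T ∈ entryLt (n + 1) lam) : (T.subdiagram n).Interlaces lam := by
  refine fun i => ⟨le_of_forall_lt fun j hj => ?_, le_of_forall_lt fun j hj => ?_⟩
  · rw [← mem_iff_lt_rowLen, mem_subdiagram] at hj
    exact mem_iff_lt_rowLen.1 hj.1
  · rw [← mem_iff_lt_rowLen] at hj
    rw [← mem_iff_lt_rowLen, mem_subdiagram]
    have h1 := T.col_strict (Nat.lt_add_one i) hj
    have h2 := mem_entryLt.1 hT _ _ hj
    exact ⟨lam.up_left_mem (Nat.le_succ i) le_rfl hj, by omega⟩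

open Classical in
/-- The restriction of a tableau to a smaller diagram. -/
noncomputable def restrict (T : SemistandardYoungTableau lam) (h : ν ≤ lam) :
    SemistandardYoungTableau ν where
  entry i j := if (i, j) ∈ ν then T i j else 0
  row_weak' hj hc := by
    rw [if_pos hc, if_pos (ν.up_left_mem le_rfl hj.le hc)]
    exact T.row_weak hj (h hc)
  col_strict' hi hc := by
    rw [if_pos hc, if_pos (ν.up_left_mem hi.le le_rfl hc)]
    exact T.col_strict hi (h hc)
  zeros' hc := if_neg hc

open Classical in
/-- The extension of a tableau with entries less than `n` by a horizontal strip filled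
with `n`. -/
noncomputable def extend (T : SemistandardYoungTableau ν) {n : ℕ} (hT : T ∈ entryLt n ν)
    (h : ν.Interlaces lam) : SemistandardYoungTableau lam where
  entry i j := if (i, j) ∈ ν then T i j else if (i, j) ∈ lam then n else 0
  row_weak' {i j1 j2} hj hc := by
    have h1 := lam.up_left_mem le_rfl hj.le hc
    rw [if_pos hc, if_pos h1]
    split_ifs with h2 h3 h3
    · exact T.row_weak hj h3
    · exact (mem_entryLt.1 hT _ _ h2).le
    · exact absurd (ν.up_left_mem le_rfl hj.le h3) h2
    · exact le_rfl
  col_strict' {i1 i2 j} hi hc := by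
    have h1 : (i1, j) ∈ ν := by
      rw [mem_iff_lt_rowLen] at hc ⊢
      exact hc.trans_le ((lam.rowLen_anti _ _ hi).trans (h i1).2)
    rw [if_pos h1, if_pos hc]
    split_ifs with h2
    · exact T.col_strict hi h2
    · exact mem_entryLt.1 hT _ _ h1
  zeros' hc := by rw [if_neg fun h1 => hc (h.le h1), if_neg hc]

open Classical in
theorem restrict_apply (T : SemistandardYoungTableau lam) (h : ν ≤ lam) (i j : ℕ) :
    T.restrict h i j = if (i, j) ∈ ν then T i j else 0 := rfl

open Classical in
theorem extend_apply (T : SemistandardYoungTableau ν) {n : ℕ} (hT : T ∈ entryLt n ν)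
    (h : ν.Interlaces lam) (i j : ℕ) :
    T.extend hT h i j = if (i, j) ∈ ν then T i j else if (i, j) ∈ lam then n else 0 := rfl

theorem subdiagram_extend (T : SemistandardYoungTableau ν) {n : ℕ} (hT : T ∈ entryLt n ν)
    (h : ν.Interlaces lam) : (T.extend hT h).subdiagram n = ν := by
  ext ⟨i, j⟩
  rw [mem_cells, mem_cells, mem_subdiagram, extend_apply]
  refine ⟨fun hc => ?_, fun hc => ⟨h.le hc, ?_⟩⟩
  · by_contra h1
    rw [if_neg h1, if_pos hc.1] at hc
    omega
  · rw [if_pos hc]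
    exact mem_entryLt.1 hT _ _ hc

end SemistandardYoungTableau

open YoungDiagram SemistandardYoungTableau

section Schur

variable {R : Type*} [CommRing R] (x : ℕ → R)

/-- The Schur polynomial of `lam` evaluated at `x 0, …, x (n - 1)`. -/
noncomputable def schurEval (n : ℕ) (lam : YoungDiagram) : R :=
  ∑ T ∈ entryLt n lam, ∏ c ∈ lam.cells, x (T c.1 c.2)

open Classical in
theorem schurEval_zero (lam : YoungDiagram) :
    schurEval x 0 lam = if lam = ⊥ then 1 else 0 := by
  have h : (entryLt 0 lam).Nonempty ↔ lam = ⊥ := by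
    constructor
    · rintro ⟨T, hT⟩
      ext ⟨i, j⟩
      simpa using fun hc => Nat.not_lt_zero _ (mem_entryLt.1 hT i j hc)
    · rintro rfl
      exact ⟨highestWeight ⊥, by simp⟩
  split_ifs with h1
  · subst h1
    have : entryLt 0 (⊥ : YoungDiagram) = {highestWeight ⊥} := by
      ext T
      simp only [mem_entryLt, Finset.mem_singleton]
      refine ⟨fun _ => ?_, fun _ => by simp⟩
      ext i j
      rw [T.zeros (notMem_bot _), (highestWeight ⊥).zeros (notMem_bot _)]
    rw [schurEval, this]
    simp
  · rw [← h, Finset.not_nonempty_iff_eq_empty] at h1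
    rw [schurEval, h1, Finset.sum_empty]

/-- The branching rule for Schur polynomials. -/
theorem schurEval_succ (n : ℕ) (lam : YoungDiagram) :
    schurEval x (n + 1) lam =
      ∑ ν ∈ below lam, schurEval x n ν * x n ^ (lam.card - ν.card) := by
  classical
  rw [schurEval, ← Finset.sum_fiberwise_of_maps_to (g := fun T => T.subdiagram n)
    fun T hT => mem_below.2 (subdiagram_interlaces hT)]
  refine Finset.sum_congr rfl fun ν hν => ?_
  rw [mem_below] at hν
  rw [schurEval, Finset.sum_mul]
  refine Finset.sum_bij' (fun T _ => T.restrict hν.le) (fun T hT => T.extend hT hν)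
    ?_ ?_ ?_ ?_ ?_
  · rintro T hT
    obtain ⟨hT', rfl⟩ := Finset.mem_filter.1 hT
    rw [mem_entryLt]
    intro i j hc
    rw [restrict_apply, if_pos hc]
    exact (mem_subdiagram.1 hc).2
  · rintro T hT
    rw [Finset.mem_filter]
    refine ⟨mem_entryLt.2 fun i j hc => ?_, subdiagram_extend T hT hν⟩
    rw [extend_apply]
    split_ifs with h
    · exact (mem_entryLt.1 hT _ _ h).trans (Nat.lt_succ_self n)
    · exact Nat.lt_succ_self n
  · rintro T hT
    obtain ⟨hT', rfl⟩ := Finset.mem_filter.1 hT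
    ext i j
    rw [extend_apply]
    split_ifs with h1 h2
    · rw [restrict_apply, if_pos h1]
    · have := mem_entryLt.1 hT' _ _ h2
      have : ¬ T i j < n := fun h3 => h1 (mem_subdiagram.2 ⟨h2, h3⟩)
      omega
    · exact (T.zeros h2).symm
  · rintro T hT
    ext i j
    rw [restrict_apply]
    split_ifs with h1
    · rw [extend_apply, if_pos h1]
    · exact (T.zeros h1).symm
  · rintro T hT
    obtain ⟨hT', rfl⟩ := Finset.mem_filter.1 hT
    have hsub : (T.subdiagram n).cells ⊆ lam.cells := cells_subset_iff.2 hν.le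
    rw [← Finset.prod_sdiff hsub, mul_comm]
    congr 1
    · refine Finset.prod_congr rfl fun c hc => ?_
      rw [restrict_apply, if_pos ((mem_cells c).1 hc)]
    · have : ∀ c ∈ lam.cells \ (T.subdiagram n).cells, x (T c.1 c.2) = x n := by
        rintro ⟨i, j⟩ hc
        rw [Finset.mem_sdiff, mem_cells, mem_cells, mem_subdiagram, not_and] at hc
        have h1 := mem_entryLt.1 hT' _ _ hc.1
        have h2 := hc.2 hc.1
        congr 1
        dsimp only
        omega
      rw [Finset.prod_congr rfl this, Finset.prod_const, Finset.card_sdiff_of_subset hsub]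

/-- The geometric series `1 / (1 - y T)`. -/
noncomputable def geomSeries (y : R) : PowerSeries R :=
  PowerSeries.mk fun r => y ^ r

/-- The generating series of the complete homogeneous symmetric polynomials in
`x 0, …, x (n - 1)`. -/
noncomputable def hsymmSeries (n : ℕ) : PowerSeries R :=
  ∏ i ∈ Finset.range n, geomSeries (x i)

/-- The generating series of the complete homogeneous symmetric polynomials in the products
`x i * x j` for `i < j < n`. -/
noncomputable def pairHsymmSeries (n : ℕ) : PowerSeries R :=
  ∏ j ∈ Finset.range n, ∏ i ∈ Finset.range j, geomSeries (x i * x j)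

theorem coeff_hsymmSeries_succ (n r : ℕ) :
    PowerSeries.coeff r (hsymmSeries x (n + 1)) =
      ∑ jk ∈ Finset.HasAntidiagonal.antidiagonal r,
        PowerSeries.coeff jk.1 (hsymmSeries x n) * x n ^ jk.2 := by
  rw [hsymmSeries, Finset.prod_range_succ, ← hsymmSeries, PowerSeries.coeff_mul]
  simp only [geomSeries, PowerSeries.coeff_mk]

theorem prod_geomSeries_mul (n : ℕ) (y : R) :
    ∏ i ∈ Finset.range n, geomSeries (x i * y) = PowerSeries.rescale y (hsymmSeries x n) := by
  rw [hsymmSeries, map_prod]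
  refine Finset.prod_congr rfl fun i _ => ?_
  ext r
  rw [PowerSeries.coeff_rescale, geomSeries, geomSeries, PowerSeries.coeff_mk,
    PowerSeries.coeff_mk, mul_pow, mul_comm]

theorem coeff_pairHsymmSeries_succ (n l : ℕ) :
    PowerSeries.coeff l (pairHsymmSeries x (n + 1)) =
      ∑ ab ∈ Finset.HasAntidiagonal.antidiagonal l,
        PowerSeries.coeff ab.1 (pairHsymmSeries x n) *
          (x n ^ ab.2 * PowerSeries.coeff ab.2 (hsymmSeries x n)) := by
  rw [pairHsymmSeries, Finset.prod_range_succ, ← pairHsymmSeries, PowerSeries.coeff_mul]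
  simp only [prod_geomSeries_mul, PowerSeries.coeff_rescale]

/-- Pieri's rule. -/
theorem schurEval_mul_coeff_hsymmSeries (n r : ℕ) (μ : YoungDiagram) :
    schurEval x n μ * PowerSeries.coeff r (hsymmSeries x n) =
      ∑ lam ∈ above μ r, schurEval x n lam := by
  classical
  induction n generalizing μ r with
  | zero =>
    simp only [schurEval_zero, hsymmSeries, Finset.range_zero, Finset.prod_empty,
      PowerSeries.coeff_one, Finset.sum_ite_eq', mem_above]
    have h : (μ.Interlaces ⊥ ∧ (⊥ : YoungDiagram).card = μ.card + r) ↔ μ = ⊥ ∧ r = 0 := by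
      constructor
      · rintro ⟨h1, h2⟩
        have h3 : μ = ⊥ := le_bot_iff.1 h1.le
        subst h3
        exact ⟨rfl, by omega⟩
      · rintro ⟨rfl, rfl⟩
        exact ⟨fun i => ⟨le_rfl, rowLen_anti _ _ _ (Nat.le_succ i)⟩, rfl⟩
    simp only [h, ite_and, ite_mul, one_mul, zero_mul]
  | succ n ih =>
    simp only [schurEval_succ]
    rw [sum_above_below μ r fun ν s => schurEval x n ν * x n ^ s, coeff_hsymmSeries_succ,
      Finset.sum_mul_sum]
    refine Finset.sum_congr rfl fun ρ _ => Finset.sum_congr rfl fun jk _ => ?_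
    rw [← Finset.sum_mul, ← ih, pow_add]
    ring

theorem coeff_hsymmSeries_mul_coeff_pairHsymmSeries (n k l : ℕ) :
    PowerSeries.coeff k (hsymmSeries x n) * PowerSeries.coeff l (pairHsymmSeries x n) =
      ∑ lam ∈ withOddCols k l, schurEval x n lam := by
  classical
  induction n generalizing k l with
  | zero =>
    simp only [schurEval_zero, hsymmSeries, pairHsymmSeries, Finset.range_zero,
      Finset.prod_empty, PowerSeries.coeff_one, Finset.sum_ite_eq', mem_withOddCols]
    have h : ((⊥ : YoungDiagram).card = k + 2 * l ∧ oddColsCount ⊥ = k) ↔ k = 0 ∧ l = 0 := by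
      have h1 : (⊥ : YoungDiagram).card = 0 := rfl
      have h2 := oddColsCount_le_card ⊥
      omega
    simp only [h, ite_and, ite_mul, one_mul, zero_mul]
  | succ n ih =>
    simp only [schurEval_succ]
    rw [sum_withOddCols_below k l fun ν s => schurEval x n ν * x n ^ s, coeff_hsymmSeries_succ,
      coeff_pairHsymmSeries_succ, Finset.sum_mul_sum]
    refine Finset.sum_congr rfl fun cp _ => Finset.sum_congr rfl fun ab _ => ?_
    simp only [← Finset.sum_mul, ← schurEval_mul_coeff_hsymmSeries]
    rw [← ih, pow_add]
    ring

theorem aeval_hsymm_eq_coeff {S σ : Type*} [CommRing S] [Algebra S R] [Fintype σ]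
    [DecidableEq σ] (y : σ → R) (r : ℕ) :
    MvPolynomial.aeval y (MvPolynomial.hsymm σ S r) =
      PowerSeries.coeff r (∏ i, geomSeries (y i)) := by
  rw [PowerSeries.coeff_prod, MvPolynomial.hsymm, map_sum]
  refine Finset.sum_bij' (fun s _ => Multiset.toFinsupp s.1)
    (fun P hP => ⟨Finsupp.toMultiset P, ?_⟩) ?_ ?_ ?_ ?_ ?_
  · rw [Finsupp.card_toMultiset, Finsupp.sum_fintype _ _ (fun _ => rfl)]
    exact (Finset.mem_finsuppAntidiag.1 hP).1
  · intro s _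
    refine Finset.mem_finsuppAntidiag.2 ⟨?_, Finset.subset_univ _⟩
    have h := Multiset.toFinsupp_sum_eq s.1
    rw [Finsupp.sum_fintype _ _ (fun _ => rfl)] at h
    exact h.trans s.2
  · exact fun _ _ => Finset.mem_univ _
  · intro s _
    exact Subtype.ext (Multiset.toFinsupp_toMultiset s.1)
  · intro P _
    exact Finsupp.toMultiset_toFinsupp P
  · intro s _
    rw [map_multiset_prod, Multiset.map_map]
    simp only [Function.comp_def, MvPolynomial.aeval_X, geomSeries, PowerSeries.coeff_mk,
      Multiset.toFinsupp_apply]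
    rw [Finset.prod_multiset_map_count]
    refine Finset.prod_subset (Finset.subset_univ _) fun i _ hi => ?_
    rw [Multiset.count_eq_zero.2 (by simpa using hi), pow_zero]

end Schur

theorem schurPoly_eq_schurEval {n : ℕ} {x : ℕ → MvPolynomial (Fin n) ℤ}
    (hx : ∀ i : Fin n, x i = MvPolynomial.X i) (lam : YoungDiagram) :
    schurPoly n lam = schurEval x n lam := by
  have h : ∀ T : SemistandardYoungTableau lam,
      (∀ c ∈ lam.cells, T c.1 c.2 < n) ↔ T ∈ (entryLt n lam : Set _) := fun T => by
    simp [entryLt]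
  rw [schurPoly]
  simp only [h]
  rw [finsum_mem_coe_finset, schurEval]
  refine Finset.sum_congr rfl fun T hT => ?_
  rw [← Finset.prod_fiberwise_of_maps_to (g := fun c => T c.1 c.2) (t := Finset.range n)
    fun c hc => Finset.mem_range.2 (mem_entryLt.1 hT _ _ ((mem_cells c).1 hc)),
    Finset.prod_range]
  refine Finset.prod_congr rfl fun i _ => ?_
  rw [← hx, ssytWeight, ← Finset.prod_const]
  exact Finset.prod_congr rfl fun c hc => by rw [(Finset.mem_filter.1 hc).2]

theorem prod_pairs_eq_prod_range {M : Type*} [CommMonoid M] (n : ℕ) (f : ℕ → ℕ → M) :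
    ∏ p : {p : Fin n × Fin n // p.1 < p.2}, f p.1.1 p.1.2 =
      ∏ j ∈ Finset.range n, ∏ i ∈ Finset.range j, f i j := by
  rw [Finset.prod_sigma']
  refine Finset.prod_bij (fun p _ => ⟨p.1.2, p.1.1⟩) ?_ ?_ ?_ ?_
  · rintro ⟨⟨i, j⟩, h⟩ _
    simpa using h
  · rintro ⟨⟨i, j⟩, h⟩ _ ⟨⟨i', j'⟩, h'⟩ _ he
    simp only [Sigma.mk.injEq, heq_eq_eq] at he
    simp only [Subtype.mk.injEq, Prod.mk.injEq]
    exact ⟨Fin.ext he.2, Fin.ext he.1⟩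
  · rintro ⟨j, i⟩ h
    simp only [Finset.mem_sigma, Finset.mem_range] at h
    exact ⟨⟨(⟨i, by omega⟩, ⟨j, h.1⟩), h.2⟩, Finset.mem_univ _, rfl⟩
  · exact fun _ _ => rfl

open MvPolynomial in
/-- **Refined Gelfand model (Schützenberger), character identity.**
`h_k(x) · h_l({x_i x_j : i < j})` equals the sum of Schur polynomials `s_λ(x_1,…,x_n)` over
partitions `λ` of `k + 2l` with exactly `k` odd columns. -/
theorem refined_gelfand_model_characters (n k l : ℕ) (hn : 0 < n) :
    hsymm (Fin n) ℤ k *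
        aeval (fun p : {p : Fin n × Fin n // p.1 < p.2} =>
            (X p.1.1 : MvPolynomial (Fin n) ℤ) * X p.1.2)
          (hsymm {p : Fin n × Fin n // p.1 < p.2} ℤ l) =
      ∑ᶠ (lam : YoungDiagram) (_ : lam.card = k + 2 * l ∧ oddColsCount lam = k),
        schurPoly n lam := by
  let x : ℕ → MvPolynomial (Fin n) ℤ := fun i => if h : i < n then X ⟨i, h⟩ else 0
  have hx : ∀ i : Fin n, x i = X i := fun i => dif_pos i.2
  have h : ∀ lam : YoungDiagram, (lam.card = k + 2 * l ∧ oddColsCount lam = k) ↔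
      lam ∈ (withOddCols k l : Set YoungDiagram) := fun lam => by simp
  simp only [h, schurPoly_eq_schurEval hx]
  rw [finsum_mem_coe_finset, ← coeff_hsymmSeries_mul_coeff_pairHsymmSeries,
    ← aeval_X_left_apply (hsymm (Fin n) ℤ k), aeval_hsymm_eq_coeff, aeval_hsymm_eq_coeff,
    hsymmSeries, pairHsymmSeries, Finset.prod_range,
    ← prod_pairs_eq_prod_range n fun i j => geomSeries (x i * x j)]
  simp only [hx]
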